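/- arXiv:1701.03213 — 2 statements merged into one kernel-verified Lean document; each statement's English description precedes it below -/
import Mathlib

section
/- Odd central moments of branch numbers of general order: for every fixed r ≥ 1 and s ≥ 0, the expectation ⟨(S_{r+1,n} − n/4^r)^{2s+1}⟩ under P_n is asymptotically equivalent, as n → ∞, to ((2s+1)!!/(2·4^{(2s+1)r}))·((4^r − 1)/3)^s·(1/5)·((4^{r+1} − 1)/3 + 4(2s+1)·(4^{r−1} − 1)/3)·n^s. -/
open MeasureTheory ProbabilityTheory Filter
open scoped NNReal Topology

/-- Binary trees: every internal node has exactly two children. -/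
inductive BinTree : Type
  | leaf : BinTree
  | node : BinTree → BinTree → BinTree
  deriving DecidableEq

namespace BinTree

/-- The magnitude of a binary tree is its number of leaves. -/
def magnitude : BinTree → ℕ
  | leaf => 1
  | node l r => magnitude l + magnitude r

/-- The Horton–Strahler order of (the root of) a binary tree:
leaves have order 1; a node whose two children have distinct orders has the max of the two;
a node whose two children have equal order `r` has order `r + 1`. -/
def ord : BinTree → ℕ
  | leaf => 1
  | node l r => if ord l = ord r then ord l + 1 else max (ord l) (ord r)

/-- `branches k τ` is `S_{k,n}(τ)`, the number of Horton–Strahler branches of order `k`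
in `τ`, i.e. the number of maximal connected paths of nodes of order `k`.  It counts the
nodes of order `k` that head a branch: a new branch head of order `ord l + 1` is created
exactly at a node whose two children have equal order `ord l`, and every leaf heads an
order-1 branch. -/
def branches (k : ℕ) : BinTree → ℕ
  | leaf => if k = 1 then 1 else 0
  | node l r => branches k l + branches k r +
      (if ord l = ord r ∧ ord l + 1 = k then 1 else 0)

end BinTree

/-- `treesOf n` is the finite set `Ω_n` of binary trees of magnitude `n`. -/
def treesOf : ℕ → Finset BinTree
  | 0 => ∅
  | 1 => {BinTree.leaf}
  | (n+2) => (Finset.range (n+1)).attach.biUnion fun k =>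
      ((treesOf (k.1+1)) ×ˢ (treesOf (n+1-k.1))).image fun p => BinTree.node p.1 p.2
  decreasing_by
  · have := Finset.mem_range.mp k.2; omega
  · omega

/-- Expectation `⟨f⟩` under the uniform probability measure `P_n` on `Ω_n` (the random model). -/
noncomputable def expect (n : ℕ) (f : BinTree → ℝ) : ℝ :=
  (∑ τ ∈ treesOf n, f τ) / (treesOf n).card

section

open BinTree Finset Asymptotics

namespace BinTree

lemma magnitude_pos (τ : BinTree) : 0 < τ.magnitude := by
  cases τ with
  | leaf => simp [magnitude]
  | node l r => have := magnitude_pos l; simp only [magnitude]; omega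

lemma ord_pos (τ : BinTree) : 0 < τ.ord := by
  cases τ with
  | leaf => simp [ord]
  | node l r =>
    have := ord_pos l
    simp only [ord]
    split_ifs <;> omega

/-- The pruning of a node in terms of the prunings of its children. -/
def mergePruned : Option BinTree → Option BinTree → Option BinTree
  | none, none => some leaf
  | none, some b => some b
  | some a, none => some a
  | some a, some b => some (node a b)

/-- Remove the branches of order 1 and contract the resulting chains; a single leaf
disappears altogether. -/
def prune : BinTree → Option BinTree
  | leaf => none
  | node l r => mergePruned l.prune r.prune

lemma prune_node (l r : BinTree) : (node l r).prune = mergePruned l.prune r.prune := rfl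

lemma prune_eq_none_iff (τ : BinTree) : τ.prune = none ↔ τ = leaf := by
  cases τ with
  | leaf => simp [prune]
  | node l r =>
    rw [prune_node]
    rcases l.prune with _ | a <;> rcases r.prune with _ | b <;> simp [mergePruned]

lemma ord_eq_prune (τ : BinTree) : τ.ord = τ.prune.elim 1 (fun a => a.ord + 1) := by
  induction τ with
  | leaf => simp [ord, prune]
  | node l r hl hr =>
    simp only [ord, prune_node, hl, hr]
    rcases l.prune with _ | a <;> rcases r.prune with _ | b <;> simp [ord, mergePruned]
    · have := ord_pos b; omega
    · have := ord_pos a; omega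
    · split_ifs <;> simp

lemma branches_eq_prune (k : ℕ) (τ : BinTree) :
    τ.branches (k + 2) = τ.prune.elim 0 (branches (k + 1)) := by
  induction τ with
  | leaf => simp [branches, prune]
  | node l r hl hr =>
    simp only [branches, prune_node, hl, hr, ord_eq_prune l, ord_eq_prune r]
    rcases l.prune with _ | a <;> rcases r.prune with _ | b <;> simp [branches, mergePruned]
    · have := ord_pos b; omega
    · have := ord_pos a; omega

lemma branches_one (τ : BinTree) : τ.branches 1 = τ.magnitude := by
  induction τ with
  | leaf => simp [branches, magnitude]
  | node l r hl hr =>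
    have := ord_pos l
    simp [branches, magnitude, hl, hr]
    omega

lemma magnitude_prune_le {τ a : BinTree} (h : τ.prune = some a) :
    a.magnitude ≤ τ.magnitude := by
  induction τ generalizing a with
  | leaf => simp [prune] at h
  | node l r hl hr =>
    rw [prune_node] at h
    rcases hl' : l.prune with _ | b <;> rcases hr' : r.prune with _ | c <;>
      simp only [hl', hr', mergePruned, Option.some.injEq] at h <;> subst h <;> simp only [magnitude]
    · have := magnitude_pos l; omega
    · have := hr hr'; omega
    · have := hl hl'; omega
    · have := hl hl'; have := hr hr'; omega

end BinTree

lemma mem_treesOf (n : ℕ) (τ : BinTree) : τ ∈ treesOf n ↔ τ.magnitude = n := by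
  induction n using Nat.strong_induction_on generalizing τ with
  | _ n ih =>
    match n with
    | 0 => simpa [treesOf] using (magnitude_pos τ).ne'
    | 1 =>
      cases τ with
      | leaf => simp [treesOf, magnitude]
      | node l r =>
        have := magnitude_pos l
        have := magnitude_pos r
        simp only [treesOf, mem_singleton, magnitude, reduceCtorEq, false_iff]
        omega
    | n + 2 =>
      rw [treesOf]
      simp only [mem_biUnion, mem_attach, true_and, Subtype.exists, mem_image, mem_product,
        Prod.exists, mem_range]
      constructor
      · rintro ⟨k, hk, l, r, ⟨h1, h2⟩, rfl⟩
        rw [ih _ (by omega)] at h1 h2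
        simp only [magnitude]
        omega
      · intro h
        cases τ with
        | leaf => simp [magnitude] at h
        | node l r =>
          have := magnitude_pos l
          have := magnitude_pos r
          simp only [magnitude] at h
          refine ⟨l.magnitude - 1, by omega, l, r, ⟨?_, ?_⟩, rfl⟩
          · rw [ih _ (by omega)]; omega
          · rw [ih _ (by omega)]; omega

lemma sum_treesOf (n : ℕ) (f : BinTree → ℝ) :
    ∑ τ ∈ treesOf (n + 2), f τ =
      ∑ q ∈ antidiagonal (n + 2), ∑ l ∈ treesOf q.1, ∑ r ∈ treesOf q.2, f (node l r) := by
  have h : treesOf (n + 2) = (antidiagonal (n + 2)).biUnion fun q =>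
      (treesOf q.1 ×ˢ treesOf q.2).image fun p => node p.1 p.2 := by
    ext τ
    simp only [mem_treesOf, mem_biUnion, mem_image, mem_product,
      HasAntidiagonal.mem_antidiagonal, Prod.exists]
    constructor
    · intro h
      cases τ with
      | leaf => simp [magnitude] at h
      | node l r => exact ⟨_, _, h, l, r, ⟨rfl, rfl⟩, rfl⟩
    · rintro ⟨i, j, h, l, r, ⟨rfl, rfl⟩, rfl⟩
      exact h
  rw [h, sum_biUnion]
  · refine sum_congr rfl fun q _ => ?_
    rw [sum_image, sum_product]
    rintro ⟨a, b⟩ _ ⟨c, d⟩ _ h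
    simpa using h
  · rintro ⟨i, j⟩ _ ⟨i', j'⟩ _ hne
    refine disjoint_left.2 fun τ h1 h2 => hne ?_
    simp only [mem_image, mem_product, mem_treesOf, Prod.exists] at h1 h2
    obtain ⟨l, r, ⟨rfl, rfl⟩, rfl⟩ := h1
    obtain ⟨l', r', ⟨rfl, rfl⟩, h⟩ := h2
    rw [node.injEq] at h
    rw [h.1, h.2]

/-- The generating series of a statistic on binary trees, by magnitude. -/
noncomputable def treeSeries (f : BinTree → ℝ) : PowerSeries ℝ :=
  PowerSeries.mk fun n => ∑ τ ∈ treesOf n, f τ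

lemma treeSeries_add (f g : BinTree → ℝ) :
    treeSeries (f + g) = treeSeries f + treeSeries g := by
  ext n
  simp [treeSeries, sum_add_distrib]

/-- The statistic equal to `f l * g r` on `node l r` and to `0` on a leaf. -/
def splitMul (f g : BinTree → ℝ) : BinTree → ℝ
  | leaf => 0
  | node l r => f l * g r

lemma treeSeries_splitMul (f g : BinTree → ℝ) :
    treeSeries (splitMul f g) = treeSeries f * treeSeries g := by
  ext n
  rw [PowerSeries.coeff_mul]
  simp only [treeSeries, PowerSeries.coeff_mk]
  match n with
  | 0 => simp [treesOf]
  | 1 =>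
    rw [Finset.Nat.antidiagonal_succ]
    simp [treesOf, splitMul]
  | n + 2 =>
    rw [sum_treesOf]
    refine sum_congr rfl fun q _ => ?_
    simp only [splitMul, sum_mul_sum]

lemma treeSeries_leaf : treeSeries (fun τ => if τ.prune = none then 1 else 0) = PowerSeries.X := by
  ext n
  rw [PowerSeries.coeff_X]
  simp only [treeSeries, PowerSeries.coeff_mk, prune_eq_none_iff, sum_ite_eq', mem_treesOf,
    magnitude]
  simp [eq_comm]

lemma card_treesOf (n : ℕ) : #(treesOf (n + 1)) = catalan n := by
  induction n using Nat.strong_induction_on with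
  | _ n ih =>
    match n with
    | 0 => simp [treesOf]
    | n + 1 =>
      have h := sum_treesOf n (fun _ => 1)
      simp only [sum_const, nsmul_eq_mul, mul_one] at h
      rw [catalan_succ', ← Nat.cast_inj (R := ℝ), h, Finset.Nat.sum_antidiagonal_succ,
        Finset.Nat.sum_antidiagonal_succ']
      simp only [treesOf, card_empty, Nat.cast_zero, mul_zero, zero_mul, zero_add]
      push_cast
      refine sum_congr rfl fun q hq => ?_
      rw [HasAntidiagonal.mem_antidiagonal] at hq
      rw [ih _ (by omega), ih _ (by omega)]

/-- The indicator of the trees that prune to `a`. -/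
def pruneInd (a τ : BinTree) : ℝ := if τ.prune = some a then 1 else 0

lemma pruneInd_leaf :
    treeSeries (pruneInd leaf) * (1 - 2 * PowerSeries.X) = PowerSeries.X ^ 2 := by
  set L : BinTree → ℝ := fun τ => if τ.prune = none then 1 else 0 with hL
  have h : pruneInd leaf =
      splitMul L L + splitMul L (pruneInd leaf) + splitMul (pruneInd leaf) L := by
    funext τ
    cases τ with
    | leaf => simp [pruneInd, splitMul, prune]
    | node l r =>
      simp only [Pi.add_apply, splitMul, pruneInd, prune_node, hL]
      obtain ⟨x, hl⟩ : ∃ x, l.prune = x := ⟨_, rfl⟩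
      obtain ⟨y, hr⟩ : ∃ y, r.prune = y := ⟨_, rfl⟩
      simp only [hl, hr]
      rcases x with _ | _ <;> rcases y with _ | _ <;>
        simp [mergePruned]
  have h2 := congrArg treeSeries h
  simp only [treeSeries_add, treeSeries_splitMul, hL, treeSeries_leaf] at h2
  linear_combination h2

lemma pruneInd_node (a b : BinTree) :
    treeSeries (pruneInd (node a b)) * (1 - 2 * PowerSeries.X) =
      treeSeries (pruneInd a) * treeSeries (pruneInd b) := by
  set L : BinTree → ℝ := fun τ => if τ.prune = none then 1 else 0 with hL
  have h : pruneInd (node a b) = splitMul (pruneInd a) (pruneInd b) +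
      splitMul L (pruneInd (node a b)) + splitMul (pruneInd (node a b)) L := by
    funext τ
    cases τ with
    | leaf => simp [pruneInd, splitMul, prune]
    | node l r =>
      simp only [Pi.add_apply, splitMul, pruneInd, prune_node, hL]
      obtain ⟨x, hl⟩ : ∃ x, l.prune = x := ⟨_, rfl⟩
      obtain ⟨y, hr⟩ : ∃ y, r.prune = y := ⟨_, rfl⟩
      simp only [hl, hr]
      rcases x with _ | _ <;> rcases y with _ | _ <;>
        simp [mergePruned, ite_and]
      split_ifs <;> rfl
  have h2 := congrArg treeSeries h
  simp only [treeSeries_add, treeSeries_splitMul, hL, treeSeries_leaf] at h2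
  linear_combination h2

lemma treeSeries_pruneInd_mul (a : BinTree) :
    treeSeries (pruneInd a) * (1 - 2 * PowerSeries.X) ^ (2 * (a.magnitude - 1) + 1) =
      PowerSeries.X ^ (2 * a.magnitude) := by
  induction a with
  | leaf => simpa [magnitude] using pruneInd_leaf
  | node a b ha hb =>
    obtain ⟨i, hi⟩ := Nat.exists_eq_add_of_lt (magnitude_pos a)
    obtain ⟨j, hj⟩ := Nat.exists_eq_add_of_lt (magnitude_pos b)
    simp only [magnitude, hi, hj] at ha hb ⊢
    have e : 2 * (0 + i + 1 + (0 + j + 1) - 1) + 1 = 1 + (2 * i + 1) + (2 * j + 1) := by omega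
    have e1 : 2 * (0 + i + 1 - 1) + 1 = 2 * i + 1 := by omega
    have e2 : 2 * (0 + j + 1 - 1) + 1 = 2 * j + 1 := by omega
    rw [e1] at ha
    rw [e2] at hb
    rw [e, pow_add, pow_add, pow_one, ← mul_assoc, ← mul_assoc, pruneInd_node, mul_add 2,
      pow_add PowerSeries.X, ← ha, ← hb]
    ring

lemma choose_series_mul (d : ℕ) :
    (PowerSeries.mk fun n => ((d + n).choose d : ℝ) * 2 ^ n) *
      (1 - 2 * PowerSeries.X) ^ (d + 1) = 1 := by
  have h := congrArg (PowerSeries.rescale (2 : ℝ))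
    (PowerSeries.mk_add_choose_mul_one_sub_pow_eq_one ℝ d)
  rw [map_mul, map_pow, map_sub, map_one, PowerSeries.rescale_X, PowerSeries.rescale_mk] at h
  have e : (PowerSeries.C (2 : ℝ)) = 2 := rfl
  simpa only [e, mul_comm ((2 : ℝ) ^ _)] using h

/-- The number of trees of magnitude `n` that prune to a given tree of magnitude `m`
(for `n ≥ 2` and `m ≥ 1`). -/
def fibreCard (n m : ℕ) : ℕ := (n - 2).choose (2 * m - 2) * 2 ^ (n - 2 * m)

lemma sum_pruneInd {n : ℕ} (hn : 2 ≤ n) (a : BinTree) :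
    ∑ τ ∈ treesOf n, pruneInd a τ = fibreCard n a.magnitude := by
  have ha := magnitude_pos a
  have h : treeSeries (pruneInd a) = PowerSeries.X ^ (2 * a.magnitude) *
      PowerSeries.mk fun n => ((2 * (a.magnitude - 1) + n).choose (2 * (a.magnitude - 1)) : ℝ)
        * 2 ^ n := by
    rw [← treeSeries_pruneInd_mul, mul_assoc, mul_comm ((1 - 2 * PowerSeries.X) ^ _),
      choose_series_mul, mul_one]
  have h2 := congrArg (PowerSeries.coeff n) h
  rw [PowerSeries.coeff_X_pow_mul'] at h2
  simp only [treeSeries, PowerSeries.coeff_mk] at h2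
  rw [h2, fibreCard]
  split_ifs with hle
  · have e1 : 2 * (a.magnitude - 1) + (n - 2 * a.magnitude) = n - 2 := by omega
    rw [e1]
    push_cast
    congr 3
    omega
  · rw [Nat.choose_eq_zero_of_lt (by omega)]
    simp

lemma sum_branches_succ {n : ℕ} (hn : 2 ≤ n) (k : ℕ) (g : ℕ → ℝ) :
    ∑ τ ∈ treesOf n, g (τ.branches (k + 2)) =
      ∑ m ∈ range (n + 1), (fibreCard n m : ℝ) * ∑ a ∈ treesOf m, g (a.branches (k + 1)) := by
  have h : ∀ τ ∈ treesOf n, g (τ.branches (k + 2)) =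
      ∑ m ∈ range (n + 1), ∑ a ∈ treesOf m, pruneInd a τ * g (a.branches (k + 1)) := by
    intro τ hτ
    rw [mem_treesOf] at hτ
    rw [branches_eq_prune]
    rcases hp : τ.prune with _ | b
    · rw [prune_eq_none_iff] at hp
      subst hp
      simp [magnitude] at hτ
      omega
    · have hb := magnitude_prune_le hp
      rw [sum_eq_single b.magnitude, sum_eq_single b]
      · simp [pruneInd, hp]
      · intro a _ hab
        simp [pruneInd, hp, hab.symm]
      · simp [mem_treesOf]
      · intro m _ hm
        refine sum_eq_zero fun a ha => ?_
        rw [mem_treesOf] at ha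
        have : b ≠ a := by rintro rfl; exact hm ha.symm
        simp [pruneInd, hp, this]
      · simp only [mem_range]
        omega
  rw [sum_congr rfl h, sum_comm]
  refine sum_congr rfl fun m _ => ?_
  rw [sum_comm, mul_sum]
  refine sum_congr rfl fun a ha => ?_
  rw [← sum_mul, sum_pruneInd hn, (mem_treesOf m a).1 ha]

/-- The probability that a uniform tree of magnitude `n ≥ 2` has `m` branches of order 2. -/
noncomputable def pruneProb (n m : ℕ) : ℝ := fibreCard n m * #(treesOf m) / #(treesOf n)

lemma pruneProb_nonneg (n m : ℕ) : 0 ≤ pruneProb n m := by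
  unfold pruneProb
  positivity

lemma pruneProb_zero (n : ℕ) : pruneProb n 0 = 0 := by
  simp [pruneProb, treesOf]

lemma card_treesOf_pos {n : ℕ} (hn : 1 ≤ n) : 0 < #(treesOf n) := by
  obtain ⟨k, rfl⟩ := Nat.exists_eq_add_of_le' hn
  rw [card_treesOf]
  have h := succ_mul_catalan_eq_centralBinom k
  have := Nat.centralBinom_pos k
  exact Nat.pos_of_ne_zero fun h0 => by simp [h0] at h; omega

lemma expect_branches_succ {n : ℕ} (hn : 2 ≤ n) (k : ℕ) (g : ℕ → ℝ) :
    _root_.expect n (fun τ => g (τ.branches (k + 2))) =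
      ∑ m ∈ range (n + 1), pruneProb n m * _root_.expect m (fun τ => g (τ.branches (k + 1))) := by
  rw [_root_.expect, sum_branches_succ hn, sum_div]
  refine sum_congr rfl fun m _ => ?_
  rcases Nat.eq_zero_or_pos m with rfl | hm
  · simp [pruneProb_zero, treesOf]
  · have := card_treesOf_pos hm
    rw [pruneProb, _root_.expect]
    field_simp

lemma sum_pruneProb {n : ℕ} (hn : 2 ≤ n) : ∑ m ∈ range (n + 1), pruneProb n m = 1 := by
  have h1 : ∀ {m : ℕ}, 1 ≤ m → _root_.expect m (fun _ => 1) = 1 := by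
    intro m hm
    have := card_treesOf_pos hm
    simp [_root_.expect, this.ne']
  have h := expect_branches_succ hn 0 (fun _ => 1)
  rw [h1 (by omega)] at h
  rw [h]
  refine sum_congr rfl fun m _ => ?_
  rcases Nat.eq_zero_or_pos m with rfl | hm
  · simp [pruneProb_zero]
  · rw [h1 hm, mul_one]

lemma fibreCard_succ {n : ℕ} (hn : 2 ≤ n) (j : ℕ) :
    4 * (2 * j + 2) * (2 * j + 1) * (fibreCard n (j + 2) : ℝ) =
      (n - 2 * j - 2) * (n - 2 * j - 3) * fibreCard n (j + 1) := by
  obtain ⟨N, rfl⟩ := Nat.exists_eq_add_of_le' hn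
  have e1 : 2 * (j + 2) - 2 = 2 * j + 1 + 1 := by omega
  have e2 : 2 * (j + 1) - 2 = 2 * j := by omega
  simp only [fibreCard, Nat.add_sub_cancel, e1, e2]
  have c1 := Nat.choose_succ_right_eq N (2 * j + 1)
  have c2 := Nat.choose_succ_right_eq N (2 * j)
  rcases le_or_gt (2 * j + 2) N with h | h
  · obtain ⟨t, rfl⟩ := Nat.exists_eq_add_of_le h
    have e3 : 2 * j + 2 + t + 2 - 2 * (j + 2) = t := by omega
    have e4 : 2 * j + 2 + t + 2 - 2 * (j + 1) = t + 2 := by omega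
    have e5 : 2 * j + 2 + t - (2 * j + 1) = t + 1 := by omega
    have e6 : 2 * j + 2 + t - 2 * j = t + 2 := by omega
    rw [e5] at c1
    rw [e6] at c2
    rw [e3, e4]
    have c1' := congrArg (Nat.cast (R := ℝ)) c1
    have c2' := congrArg (Nat.cast (R := ℝ)) c2
    push_cast at c1' c2' ⊢
    rw [pow_add]
    linear_combination (4 * (2 * j + 1) * 2 ^ t) * c1' + 4 * (t + 1) * 2 ^ t * c2'
  · rw [Nat.choose_eq_zero_of_lt (by omega : N < 2 * j + 1 + 1)]
    rcases (by omega : N = 2 * j + 1 ∨ N = 2 * j ∨ N < 2 * j) with rfl | rfl | h'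
    · push_cast; ring
    · push_cast; ring
    · rw [Nat.choose_eq_zero_of_lt h']
      simp

lemma pruneProb_succ {n : ℕ} (hn : 2 ≤ n) (m : ℕ) :
    4 * (m + 1) * m * pruneProb n (m + 1) = (n - 2 * m) * (n - 2 * m - 1) * pruneProb n m := by
  rcases m with _ | j
  · simp [pruneProb_zero]
  · have h1 := succ_mul_catalan_eq_centralBinom j
    have h2 := succ_mul_catalan_eq_centralBinom (j + 1)
    have h3 := Nat.succ_mul_centralBinom_succ j
    have h4 := fibreCard_succ hn j
    have hc : ((j : ℝ) + 2) * catalan (j + 1) = 2 * (2 * j + 1) * catalan j := by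
      rw [← h1, ← h2] at h3
      have h5 : ((j : ℝ) + 1) * ((j + 2) * catalan (j + 1)) =
          (j + 1) * (2 * (2 * j + 1) * catalan j) := by
        have := congrArg (Nat.cast (R := ℝ)) h3
        push_cast at this
        linear_combination this
      exact mul_left_cancel₀ (by positivity) h5
    simp only [pruneProb, card_treesOf]
    push_cast
    rw [mul_div_assoc', mul_div_assoc']
    congr 1
    linear_combination (4 * (j + 1) * (fibreCard n (j + 2) : ℝ)) * hc + catalan j * h4

lemma pruneProb_self {n : ℕ} (hn : 2 ≤ n) : pruneProb n n = 0 := by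
  rw [pruneProb, fibreCard, Nat.choose_eq_zero_of_lt (by omega)]
  simp

lemma sum_pruneProb_shift {n : ℕ} (hn : 2 ≤ n) (f : ℝ → ℝ) :
    ∑ m ∈ range (n + 1), pruneProb n m * (4 * m * (m - 1) * f m) =
      ∑ m ∈ range (n + 1), pruneProb n m * ((n - 2 * m) * (n - 2 * m - 1) * f (m + 1)) := by
  rw [sum_range_succ', sum_range_succ]
  simp only [pruneProb_self hn, pruneProb_zero, zero_mul, add_zero]
  refine sum_congr rfl fun m _ => ?_
  have h := pruneProb_succ hn m
  push_cast
  linear_combination f (m + 1) * h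

/-- The scale `n ↦ n ^ (e / 2)`. -/
noncomputable def sqrtPow (e : ℤ) (n : ℕ) : ℝ := √(n : ℝ) ^ e

lemma one_le_sqrt_natCast {n : ℕ} (hn : 1 ≤ n) : 1 ≤ √(n : ℝ) :=
  Real.one_le_sqrt.2 (by exact_mod_cast hn)

lemma sqrtPow_pos (e : ℤ) {n : ℕ} (hn : 1 ≤ n) : 0 < sqrtPow e n :=
  zpow_pos (zero_lt_one.trans_le (one_le_sqrt_natCast hn)) _

lemma sqrtPow_mul (a b : ℤ) {n : ℕ} (hn : 1 ≤ n) :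
    sqrtPow a n * sqrtPow b n = sqrtPow (a + b) n :=
  (zpow_add₀ (zero_lt_one.trans_le (one_le_sqrt_natCast hn)).ne' _ _).symm

lemma sqrtPow_mono {a b : ℤ} (h : a ≤ b) {n : ℕ} (hn : 1 ≤ n) : sqrtPow a n ≤ sqrtPow b n :=
  zpow_le_zpow_right₀ (one_le_sqrt_natCast hn) h

lemma sqrtPow_natCast (k n : ℕ) : sqrtPow k n = √(n : ℝ) ^ k := by
  rw [sqrtPow, zpow_natCast]

lemma sqrtPow_two_mul (d n : ℕ) : sqrtPow (2 * d) n = (n : ℝ) ^ d := by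
  have : (2 * d : ℤ) = ((2 * d : ℕ) : ℤ) := by push_cast; rfl
  rw [this, sqrtPow_natCast, pow_mul, Real.sq_sqrt (Nat.cast_nonneg n)]

lemma sqrtPow_isBigO {a b : ℤ} (h : a ≤ b) : sqrtPow a =O[atTop] sqrtPow b := by
  refine IsBigO.of_bound 1 ?_
  filter_upwards [eventually_ge_atTop 1] with n hn
  rw [Real.norm_of_nonneg (sqrtPow_pos a hn).le, Real.norm_of_nonneg (sqrtPow_pos b hn).le,
    one_mul]
  exact sqrtPow_mono h hn

lemma isBigO_sqrtPow_mul {u v : ℕ → ℝ} {a b c : ℤ} (hu : u =O[atTop] sqrtPow a)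
    (hv : v =O[atTop] sqrtPow b) (h : a + b ≤ c) :
    (fun n => u n * v n) =O[atTop] sqrtPow c := by
  refine (hu.mul hv).trans (IsBigO.trans (EventuallyEq.isBigO ?_) (sqrtPow_isBigO h))
  filter_upwards [eventually_ge_atTop 1] with n hn
  exact sqrtPow_mul a b hn

lemma natCast_pow_isBigO_sqrtPow {d : ℕ} {a : ℤ} (h : 2 * d ≤ a) :
    (fun n : ℕ => (n : ℝ) ^ d) =O[atTop] sqrtPow a := by
  refine IsBigO.trans (EventuallyEq.isBigO ?_) (sqrtPow_isBigO h)
  exact Eventually.of_forall fun n => (sqrtPow_two_mul d n).symm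

lemma const_isBigO_sqrtPow (c : ℝ) {a : ℤ} (h : 0 ≤ a) :
    (fun _ : ℕ => c) =O[atTop] sqrtPow a := by
  have := (natCast_pow_isBigO_sqrtPow (d := 0) (a := a) (by simpa using h)).const_mul_left c
  simpa using this

lemma natCast_isBigO_sqrtPow {a : ℤ} (h : 2 ≤ a) :
    (fun n : ℕ => (n : ℝ)) =O[atTop] sqrtPow a := by
  simpa using natCast_pow_isBigO_sqrtPow (d := 1) (a := a) (by simpa using h)

/-- `u n = c * n ^ ⌊k / 2⌋ + O(n ^ (k / 2 - 1))`. -/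
def HasLead (k : ℕ) (u : ℕ → ℝ) (c : ℝ) : Prop :=
  (fun n : ℕ => u n - c * (n : ℝ) ^ (k / 2)) =O[atTop] sqrtPow (k - 2)

namespace HasLead

variable {k : ℕ} {u v : ℕ → ℝ} {c d : ℝ}

lemma isBigO (h : HasLead k u c) : u =O[atTop] sqrtPow k := by
  have h1 := h.trans (sqrtPow_isBigO (b := k) (by omega))
  have h2 : (fun n : ℕ => c * (n : ℝ) ^ (k / 2)) =O[atTop] sqrtPow k :=
    (natCast_pow_isBigO_sqrtPow (by omega)).const_mul_left c
  simpa using h1.add h2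

lemma of_isBigO (h : u =O[atTop] sqrtPow (k - 2)) : HasLead k u 0 := by
  simpa [HasLead] using h

lemma zero : HasLead k (fun _ => 0) 0 := of_isBigO (isBigO_zero _ _)

lemma add (hu : HasLead k u c) (hv : HasLead k v d) :
    HasLead k (fun n => u n + v n) (c + d) :=
  (IsBigO.add hu hv).congr_left fun n => by ring

lemma const_mul (a : ℝ) (hu : HasLead k u c) : HasLead k (fun n => a * u n) (a * c) :=
  (IsBigO.const_mul_left hu a).congr_left fun n => by ring

lemma congr' (hu : HasLead k u c) (h : ∀ᶠ n in atTop, u n = v n) (hc : c = d) :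
    HasLead k v d := by
  subst hc
  refine IsBigO.congr' hu ?_ EventuallyEq.rfl
  filter_upwards [h] with n hn
  rw [hn]

lemma sum {ι : Type*} (s : Finset ι) {f : ι → ℕ → ℝ} {a : ι → ℝ}
    (h : ∀ i ∈ s, HasLead k (f i) (a i)) :
    HasLead k (fun n => ∑ i ∈ s, f i n) (∑ i ∈ s, a i) := by
  refine (IsBigO.sum (fun i hi => h i hi)).congr_left fun n => ?_
  simp only [Finset.sum_apply, Finset.sum_sub_distrib, Finset.sum_mul]

lemma pow_mul (e : ℕ) (hu : HasLead k u c) :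
    HasLead (k + 2 * e) (fun n => (n : ℝ) ^ e * u n) c := by
  have h := isBigO_sqrtPow_mul (natCast_pow_isBigO_sqrtPow (le_refl (2 * (e : ℤ)))) hu
    (c := ((k + 2 * e : ℕ) : ℤ) - 2) (by push_cast; linarith)
  refine h.congr_left fun n => ?_
  rw [Nat.add_mul_div_left _ _ two_pos, pow_add]
  ring

lemma succ (hu : HasLead k u c) : HasLead (k + 1) u (if Even k then c else 0) := by
  split_ifs with hk
  · have e : (k + 1) / 2 = k / 2 := by obtain ⟨j, rfl⟩ := hk; omega
    rw [HasLead, e]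
    exact IsBigO.trans hu (sqrtPow_isBigO (by push_cast; omega))
  · refine of_isBigO ?_
    have h1 := IsBigO.trans hu (sqrtPow_isBigO (b := ((k + 1 : ℕ) : ℤ) - 2) (by push_cast; omega))
    have h2 : (fun n : ℕ => c * (n : ℝ) ^ (k / 2)) =O[atTop] sqrtPow (((k + 1 : ℕ) : ℤ) - 2) :=
      (natCast_pow_isBigO_sqrtPow (by
        obtain ⟨j, rfl⟩ := Nat.not_even_iff_odd.1 hk; omega)).const_mul_left c
    simpa using h1.add h2

lemma div_linear (a : ℝ) (h : HasLead (k + 2) (fun n => (4 * n - a) * v n) d) :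
    HasLead k v (d / 4) := by
  have hlarge : ∀ᶠ n : ℕ in atTop, 1 ≤ n ∧ |a| ≤ n :=
    (eventually_ge_atTop 1).and (tendsto_natCast_atTop_atTop.eventually_ge_atTop |a|)
  have hn_inv : (fun n : ℕ => (n : ℝ)⁻¹) =O[atTop] sqrtPow (-2) := by
    refine EventuallyEq.isBigO ?_
    filter_upwards with n
    rw [sqrtPow, zpow_neg, zpow_ofNat, Real.sq_sqrt (Nat.cast_nonneg n)]
  have hinv : (fun n : ℕ => (4 * (n : ℝ) - a)⁻¹) =O[atTop] sqrtPow (-2) := by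
    refine IsBigO.trans (IsBigO.of_bound 1 ?_) hn_inv
    filter_upwards [hlarge] with n ⟨hn, ha⟩
    have hn' : (1 : ℝ) ≤ n := by exact_mod_cast hn
    have := le_abs_self a
    rw [norm_inv, norm_inv, one_mul, Real.norm_of_nonneg (by linarith),
      Real.norm_of_nonneg (by linarith)]
    exact inv_anti₀ (by linarith) (by linarith)
  have hv : v =O[atTop] sqrtPow k := by
    refine IsBigO.congr' (isBigO_sqrtPow_mul h.isBigO hinv (c := k) (by push_cast; linarith)) ?_
      EventuallyEq.rfl
    filter_upwards [hlarge] with n ⟨hn, ha⟩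
    have hn' : (1 : ℝ) ≤ n := by exact_mod_cast hn
    have := le_abs_self a
    have : 4 * (n : ℝ) - a ≠ 0 := by linarith
    field_simp
  have h1 : (fun n : ℕ => (4 * n - a) * v n - d * (n : ℝ) ^ ((k + 2) / 2) + a * v n)
      =O[atTop] sqrtPow k := by
    refine IsBigO.add (IsBigO.trans h (sqrtPow_isBigO (by push_cast; linarith))) ?_
    exact hv.const_mul_left a
  refine IsBigO.congr' ((isBigO_sqrtPow_mul hn_inv h1 (c := k - 2) (by linarith)).const_mul_left
    (1 / 4)) ?_ EventuallyEq.rfl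
  filter_upwards [eventually_ge_atTop 1] with n hn
  have hn' : (n : ℝ) ≠ 0 := by positivity
  have e : (k + 2) / 2 = k / 2 + 1 := by omega
  rw [e, pow_succ]
  field_simp
  ring

end HasLead

/-- The `k`-th moment, about `n / 4`, of the number of branches of order 2. -/
noncomputable def pruneMoment (k n : ℕ) : ℝ :=
  ∑ m ∈ range (n + 1), pruneProb n m * ((m : ℝ) - n / 4) ^ k

lemma add_one_pow_expand (k : ℕ) (x : ℝ) :
    (x + 1) ^ k = x ^ k + k * x ^ (k - 1) + k.choose 2 * x ^ (k - 2) +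
      ∑ i ∈ range (k - 2), (k.choose i : ℝ) * x ^ i := by
  match k with
  | 0 => simp
  | 1 => simp
  | k + 2 =>
    rw [add_pow, sum_range_succ, sum_range_succ, sum_range_succ]
    have h1 : (k + 2).choose (k + 1) = k + 2 := by
      rw [← Nat.choose_symm_of_eq_add (n := k + 2) (a := 1) (b := k + 1) (by omega)]; simp
    have h2 : (k + 2).choose k = (k + 2).choose 2 :=
      Nat.choose_symm_of_eq_add (by omega)
    simp only [one_pow, mul_one, Nat.choose_self, h1, h2, Nat.add_sub_cancel]
    have e : k + 2 - 1 = k + 1 := by omega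
    rw [e, sum_congr rfl fun i _ => mul_comm (x ^ i) _]
    push_cast
    ring

/-- The error term of `pruneMoment_rec`. -/
noncomputable def recError (k n : ℕ) : ℝ :=
  (((n : ℝ) ^ 2 - 2 * n) / 4) * ∑ i ∈ range (k - 2), (k.choose i : ℝ) * pruneMoment i n
    + (2 - 2 * n) * ∑ i ∈ range (k - 2), (k.choose i : ℝ) * pruneMoment (i + 1) n
    + 4 * ∑ i ∈ range (k - 2), (k.choose i : ℝ) * pruneMoment (i + 2) n
    - n / 2 * (k * pruneMoment (k - 1) n)
    - n / 2 * (k.choose 2 * pruneMoment (k - 2) n)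
    + (2 - 2 * n) * (k.choose 2 * pruneMoment (k - 1) n)
    + (4 * k.choose 2 + 2 * k) * pruneMoment k n

lemma sum_pruneMoment (s : Finset ℕ) (a : ℕ → ℝ) (e : ℕ → ℕ) (n : ℕ) :
    ∑ i ∈ s, a i * pruneMoment (e i) n =
      ∑ m ∈ range (n + 1), pruneProb n m * ∑ i ∈ s, a i * ((m : ℝ) - n / 4) ^ e i := by
  simp only [pruneMoment, mul_sum]
  rw [sum_comm]
  exact sum_congr rfl fun m _ => sum_congr rfl fun i _ => by ring

lemma pruneMoment_rec (k : ℕ) {n : ℕ} (hn : 2 ≤ n) :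
    (4 * n - (4 * k + 6)) * pruneMoment (k + 1) n =
      (n : ℝ) ^ 2 / 4 * (k * pruneMoment (k - 1) n + k.choose 2 * pruneMoment (k - 2) n)
        + n * (1 / 2 - 2 * k) * pruneMoment k n + recError k n := by
  have h := sum_pruneProb_shift hn (fun m => (m - (n : ℝ) / 4) ^ k)
  rw [recError, sum_pruneMoment _ _ (fun i => i), sum_pruneMoment _ _ (fun i => i + 1),
    sum_pruneMoment _ _ (fun i => i + 2)]
  simp only [pruneMoment]
  rw [← sub_eq_zero] at h ⊢
  simp only [mul_sum, ← sum_add_distrib, ← sum_sub_distrib] at h ⊢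
  rw [← h]
  refine sum_congr rfl fun m _ => ?_
  set x : ℝ := (m : ℝ) - n / 4 with hx
  have hm : (m : ℝ) = x + n / 4 := by rw [hx]; ring
  have hx1 : (m : ℝ) + 1 - n / 4 = x + 1 := by rw [hx]; ring
  have hk1 : (k : ℝ) * x ^ k = x * (k * x ^ (k - 1)) := by
    rcases k with _ | k
    · simp
    · rw [Nat.add_sub_cancel, pow_succ]; ring
  have hk2 : (k.choose 2 : ℝ) * x ^ (k - 1) = x * (k.choose 2 * x ^ (k - 2)) := by
    match k with
    | 0 => simp
    | 1 => simp
    | k + 2 => rw [Nat.add_sub_cancel, (by omega : k + 2 - 1 = k + 1), pow_succ]; ring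
  have hk3 : (k.choose 2 : ℝ) * x ^ k = x ^ 2 * (k.choose 2 * x ^ (k - 2)) := by
    match k with
    | 0 => simp
    | 1 => simp
    | k + 2 => rw [Nat.add_sub_cancel, pow_add]; ring
  have hs1 : ∑ i ∈ range (k - 2), (k.choose i : ℝ) * x ^ (i + 1) =
      x * ∑ i ∈ range (k - 2), (k.choose i : ℝ) * x ^ i := by
    rw [mul_sum]; exact sum_congr rfl fun i _ => by ring
  have hs2 : ∑ i ∈ range (k - 2), (k.choose i : ℝ) * x ^ (i + 2) =
      x ^ 2 * ∑ i ∈ range (k - 2), (k.choose i : ℝ) * x ^ i := by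
    rw [mul_sum]; exact sum_congr rfl fun i _ => by ring
  simp only [sum_add_distrib, ← mul_sum]
  rw [hx1, hm, add_one_pow_expand, hs1, hs2]
  set Q := ∑ i ∈ range (k - 2), (k.choose i : ℝ) * x ^ i
  rw [pow_succ]
  linear_combination pruneProb n m * (-4 * x + 2 * n - 2) * hk1 -
    pruneProb n m * (2 - 2 * n) * hk2 - 4 * pruneProb n m * hk3

/-- The leading coefficients of the central moments of branch numbers: `2 * v` and `p` are the
coefficients of the variance and of the mean, `w` accounts for the skewness. -/
noncomputable def leadCoeff (v p w : ℝ) (k : ℕ) : ℝ :=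
  if Even k then (k.factorial : ℝ) / (k / 2).factorial * v ^ (k / 2)
  else (k.factorial : ℝ) / (k / 2).factorial *
    (p * v ^ (k / 2) + w * ((k / 2 : ℕ) * v ^ (k / 2 - 1)))

lemma leadCoeff_even (v p w : ℝ) (i : ℕ) :
    leadCoeff v p w (2 * i) = ((2 * i).factorial : ℝ) / i.factorial * v ^ i := by
  simp [leadCoeff]

lemma leadCoeff_odd (v p w : ℝ) (i : ℕ) :
    leadCoeff v p w (2 * i + 1) = ((2 * i + 1).factorial : ℝ) / i.factorial *
      (p * v ^ i + w * (i * v ^ (i - 1))) := by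
  have e : (2 * i + 1) / 2 = i := by omega
  simp [leadCoeff, e]

lemma recError_isBigO {k : ℕ} (h : ∀ i ≤ k, pruneMoment i =O[atTop] sqrtPow i) :
    recError k =O[atTop] sqrtPow (k + 1) := by
  have hsum : ∀ e ≤ 2, (fun n => ∑ i ∈ range (k - 2), (k.choose i : ℝ) * pruneMoment (i + e) n)
      =O[atTop] sqrtPow (k - 3 + e) := by
    intro e he
    refine IsBigO.fun_sum fun i hi => IsBigO.const_mul_left ?_ _
    rw [mem_range] at hi
    exact (h _ (by omega)).trans (sqrtPow_isBigO (by push_cast; omega))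
  have hk1 : (fun n => (k : ℝ) * pruneMoment (k - 1) n) =O[atTop] sqrtPow (k - 1) := by
    rcases k with _ | k
    · simpa using isBigO_zero _ _
    · exact ((h _ (by omega)).trans (sqrtPow_isBigO (by simp))).const_mul_left _
  have hk2 : (fun n => (k.choose 2 : ℝ) * pruneMoment (k - 2) n) =O[atTop] sqrtPow (k - 2) := by
    match k with
    | 0 => simpa using isBigO_zero _ _
    | 1 => simpa using isBigO_zero _ _
    | k + 2 => exact ((h _ (by omega)).trans (sqrtPow_isBigO (by simp))).const_mul_left _
  have hk3 : (fun n => (k.choose 2 : ℝ) * pruneMoment (k - 1) n) =O[atTop] sqrtPow (k - 1) := by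
    rcases k with _ | k
    · simpa using isBigO_zero _ _
    · exact ((h _ (by omega)).trans (sqrtPow_isBigO (by simp))).const_mul_left _
  have hn : (fun n : ℕ => (n : ℝ) / 2) =O[atTop] sqrtPow 2 := by
    simpa [div_eq_inv_mul] using (natCast_isBigO_sqrtPow le_rfl).const_mul_left 2⁻¹
  have hn1 : (fun n : ℕ => 2 - 2 * (n : ℝ)) =O[atTop] sqrtPow 2 :=
    (const_isBigO_sqrtPow 2 (by norm_num)).sub
      ((natCast_isBigO_sqrtPow le_rfl).const_mul_left 2)
  have hn2 : (fun n : ℕ => ((n : ℝ) ^ 2 - 2 * n) / 4) =O[atTop] sqrtPow 4 := by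
    have := ((natCast_pow_isBigO_sqrtPow (d := 2) (a := 4) (by norm_num)).sub
      ((natCast_isBigO_sqrtPow (a := 4) (by norm_num)).const_mul_left 2)).const_mul_left 4⁻¹
    simpa [div_eq_inv_mul] using this
  refine IsBigO.add (IsBigO.add (IsBigO.sub (IsBigO.sub (IsBigO.add (IsBigO.add ?_ ?_) ?_) ?_) ?_)
    ?_) ?_
  · exact isBigO_sqrtPow_mul hn2 (hsum 0 (by norm_num)) (by push_cast; linarith)
  · exact isBigO_sqrtPow_mul hn1 (hsum 1 (by norm_num)) (by push_cast; linarith)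
  · exact ((hsum 2 le_rfl).trans (sqrtPow_isBigO (by push_cast; linarith))).const_mul_left 4
  · exact isBigO_sqrtPow_mul hn hk1 (by linarith)
  · exact isBigO_sqrtPow_mul hn hk2 (by linarith)
  · exact isBigO_sqrtPow_mul hn1 hk3 (by linarith)
  · exact ((h k le_rfl).trans (sqrtPow_isBigO (by linarith))).const_mul_left _

lemma leadCoeff_rec (k : ℕ) :
    k * leadCoeff (1 / 32) (1 / 8) 0 (k - 1) / 4 +
      (if Even k then k.choose 2 * leadCoeff (1 / 32) (1 / 8) 0 (k - 2) / 4 +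
        (1 / 2 - 2 * k) * leadCoeff (1 / 32) (1 / 8) 0 k else 0) =
      4 * leadCoeff (1 / 32) (1 / 8) 0 (k + 1) := by
  rcases Nat.even_or_odd' k with ⟨s, rfl | rfl⟩
  · rw [if_pos (even_two_mul s)]
    rcases s with _ | s
    · simp [leadCoeff]
      norm_num
    · have e1 : 2 * (s + 1) - 1 = 2 * s + 1 := by omega
      have e2 : 2 * (s + 1) - 2 = 2 * s := by omega
      rw [e1, e2, leadCoeff_even, leadCoeff_even, leadCoeff_odd, leadCoeff_odd,
        Nat.cast_choose_two]
      have f1 : 2 * (s + 1) = 2 * s + 1 + 1 := by ring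
      rw [f1]
      simp only [Nat.factorial_succ]
      push_cast
      field_simp
      ring
  · rw [if_neg (by simp)]
    have e1 : 2 * s + 1 - 1 = 2 * s := by omega
    have e2 : 2 * s + 1 + 1 = 2 * (s + 1) := by ring
    rw [e1, e2, leadCoeff_even, leadCoeff_even]
    have f1 : 2 * (s + 1) = 2 * s + 1 + 1 := by ring
    rw [f1]
    simp only [Nat.factorial_succ]
    push_cast
    field_simp
    ring

lemma pruneMoment_hasLead (k : ℕ) :
    HasLead k (pruneMoment k) (leadCoeff (1 / 32) (1 / 8) 0 k) := by
  induction k using Nat.strong_induction_on with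
  | _ k ih =>
    rcases k with _ | k
    · refine HasLead.congr' (k := 0) (u := fun _ => 1) (c := 1) ?_ ?_ ?_
      · simpa [HasLead] using isBigO_zero _ _
      · filter_upwards [eventually_ge_atTop 2] with n hn
        simp [pruneMoment, sum_pruneProb hn]
      · simp [leadCoeff]
    · have hk1 : HasLead (k + 3) (fun n => (n : ℝ) ^ 2 * (k * pruneMoment (k - 1) n))
          (k * leadCoeff (1 / 32) (1 / 8) 0 (k - 1)) := by
        rcases k with _ | k
        · simpa using HasLead.zero
        · simpa using ((ih k (by omega)).const_mul ((k + 1 : ℕ) : ℝ)).pow_mul 2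
      have hk2 : HasLead (k + 2) (fun n => (n : ℝ) ^ 2 * (k.choose 2 * pruneMoment (k - 2) n))
          (k.choose 2 * leadCoeff (1 / 32) (1 / 8) 0 (k - 2)) := by
        match k with
        | 0 => simpa using HasLead.zero
        | 1 => simpa using HasLead.zero
        | k + 2 => exact ((ih k (by omega)).const_mul ((k + 2).choose 2 : ℝ)).pow_mul 2
      have hk3 : HasLead (k + 2) (fun n => (n : ℝ) ^ 1 * pruneMoment k n)
          (leadCoeff (1 / 32) (1 / 8) 0 k) := (ih k (by omega)).pow_mul 1
      have herr : HasLead (k + 3) (recError k) 0 := by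
        refine HasLead.of_isBigO ?_
        refine (recError_isBigO fun i hi => (ih i (by omega)).isBigO).trans (sqrtPow_isBigO ?_)
        push_cast; linarith
      have hmain := ((hk1.const_mul (1 / 4)).add
        ((hk2.const_mul (1 / 4)).add (hk3.const_mul (1 / 2 - 2 * k))).succ).add herr
      have hc := leadCoeff_rec k
      refine (HasLead.div_linear (4 * k + 6) (d := 4 * leadCoeff (1 / 32) (1 / 8) 0 (k + 1))
        (hmain.congr' ?_ ?_)).congr' (Eventually.of_forall fun n => rfl) (by ring)
      · filter_upwards [eventually_ge_atTop 2] with n hn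
        rw [pruneMoment_rec k hn]
        ring
      · have : Even (k + 2) ↔ Even k := by simp [Nat.even_add]
        rw [← hc]
        simp only [this]
        split_ifs <;> ring

/-- The `l`-th absolute moment, about `n / 4`, of the number of branches of order 2. -/
noncomputable def pruneAbsMoment (l n : ℕ) : ℝ :=
  ∑ m ∈ range (n + 1), pruneProb n m * |(m : ℝ) - n / 4| ^ l

lemma pruneAbsMoment_nonneg (l n : ℕ) : 0 ≤ pruneAbsMoment l n :=
  sum_nonneg fun m _ => mul_nonneg (pruneProb_nonneg n m) (by positivity)

lemma pruneAbsMoment_isBigO (l : ℕ) : pruneAbsMoment l =O[atTop] sqrtPow l := by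
  rcases Nat.even_or_odd' l with ⟨h, rfl | rfl⟩
  · have e : pruneAbsMoment (2 * h) = pruneMoment (2 * h) := by
      funext n
      simp only [pruneAbsMoment, pruneMoment, (even_two_mul h).pow_abs]
    rw [e]
    exact (pruneMoment_hasLead _).isBigO
  · have h0 := (pruneMoment_hasLead (2 * h)).isBigO
    have h2 := (pruneMoment_hasLead (2 * h + 2)).isBigO
    have hs := (isBigO_sqrtPow_mul (isBigO_refl (sqrtPow 1) atTop) h0
      (c := (2 * h + 1 : ℕ)) (by push_cast; linarith)).add
      (isBigO_sqrtPow_mul (isBigO_refl (sqrtPow (-1)) atTop) h2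
        (c := (2 * h + 1 : ℕ)) (by push_cast; linarith))
    refine IsBigO.trans (IsBigO.of_bound 1 ?_) hs
    filter_upwards [eventually_ge_atTop 1] with n hn
    have hq := zero_lt_one.trans_le (one_le_sqrt_natCast hn)
    rw [Real.norm_of_nonneg (pruneAbsMoment_nonneg _ _), one_mul]
    refine le_trans ?_ (le_abs_self _)
    simp only [pruneAbsMoment, pruneMoment, mul_sum, ← sum_add_distrib]
    refine sum_le_sum fun m _ => ?_
    set x : ℝ := (m : ℝ) - n / 4
    have key : |x| ^ (2 * h + 1) ≤ sqrtPow 1 n * x ^ (2 * h) + sqrtPow (-1) n * x ^ (2 * h + 2) := by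
      have e1 : |x| ^ (2 * h) = x ^ (2 * h) := (even_two_mul h).pow_abs x
      have e2 : |x| ≤ √(n : ℝ) + (√(n : ℝ))⁻¹ * x ^ 2 := by
        rw [← sq_abs x, ← sub_nonneg]
        have : √(n : ℝ) + (√(n : ℝ))⁻¹ * |x| ^ 2 - |x| =
            (√(n : ℝ))⁻¹ * ((√(n : ℝ) - |x|) ^ 2 + √(n : ℝ) * |x|) := by
          field_simp
          ring
        rw [this]
        positivity
      have e3 : 0 ≤ x ^ (2 * h) := (even_two_mul h).pow_nonneg x
      rw [sqrtPow, sqrtPow, zpow_one, zpow_neg_one, pow_succ, e1, pow_add]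
      nlinarith [mul_le_mul_of_nonneg_left e2 e3]
    nlinarith [mul_le_mul_of_nonneg_left key (pruneProb_nonneg n m)]

lemma sqrtPow_sub_two_le {m n j : ℕ} (hm : 1 ≤ m) (hmn : m ≤ n) :
    sqrtPow (j - 2) m ≤
      sqrtPow j n * (8 * sqrtPow (-2) n + 64 * sqrtPow (-4) n * |(m : ℝ) - n / 4| ^ 2) := by
  have hm' : (1 : ℝ) ≤ m := by exact_mod_cast hm
  have hmn' : (m : ℝ) ≤ n := by exact_mod_cast hmn
  have hn0 : (0 : ℝ) < n := by linarith
  have e1 : sqrtPow (-2) n = (n : ℝ)⁻¹ := by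
    rw [sqrtPow, zpow_neg, zpow_ofNat, Real.sq_sqrt hn0.le]
  have e2 : sqrtPow (-4) n = ((n : ℝ) ^ 2)⁻¹ := by
    rw [sqrtPow, zpow_neg, zpow_ofNat, (by norm_num : 4 = 2 * 2), pow_mul, Real.sq_sqrt hn0.le]
  have e3 : sqrtPow (j - 2) m = √(m : ℝ) ^ j * (m : ℝ)⁻¹ := by
    rw [sub_eq_add_neg, ← sqrtPow_mul _ _ hm, sqrtPow_natCast, sqrtPow, zpow_neg, zpow_ofNat,
      Real.sq_sqrt (by linarith)]
  rw [e1, e2, e3, sqrtPow_natCast, sq_abs]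
  refine mul_le_mul (pow_le_pow_left₀ (Real.sqrt_nonneg _) (Real.sqrt_le_sqrt hmn') _) ?_
    (by positivity) (by positivity)
  rcases le_or_gt ((n : ℝ) / 8) m with h | h
  · have : (m : ℝ)⁻¹ ≤ 8 * (n : ℝ)⁻¹ := by
      have := inv_anti₀ (by positivity) h
      rwa [inv_div, div_eq_mul_inv] at this
    have : 0 ≤ 64 * ((n : ℝ) ^ 2)⁻¹ * ((m : ℝ) - n / 4) ^ 2 := by positivity
    linarith
  · have h1 : (m : ℝ)⁻¹ ≤ 1 := inv_le_one_of_one_le₀ hm'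
    have h2 : 1 ≤ 64 * ((n : ℝ) ^ 2)⁻¹ * ((m : ℝ) - n / 4) ^ 2 := by
      have h3 : (n : ℝ) ^ 2 ≤ 64 * ((m : ℝ) - n / 4) ^ 2 := by nlinarith
      have : 64 * ((n : ℝ) ^ 2)⁻¹ * ((m : ℝ) - n / 4) ^ 2 =
          64 * ((m : ℝ) - n / 4) ^ 2 / n ^ 2 := by field_simp
      rw [this, le_div_iff₀ (by positivity)]
      linarith
    have : 0 ≤ 8 * (n : ℝ)⁻¹ := by positivity
    linarith

lemma exists_bound_of_isBigO {f : ℕ → ℝ} {e : ℤ} (h : f =O[atTop] sqrtPow e) :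
    ∃ C, 0 ≤ C ∧ ∀ m, 1 ≤ m → |f m| ≤ C * sqrtPow e m := by
  have h1 : (fun n => f (n + 1)) =O[atTop] fun n => sqrtPow e (n + 1) :=
    h.comp_tendsto (tendsto_add_atTop_nat 1)
  obtain ⟨C, hC, hb⟩ := bound_of_isBigO_nat_atTop h1
  refine ⟨C, hC.le, fun m hm => ?_⟩
  obtain ⟨k, rfl⟩ := Nat.exists_eq_add_of_le' hm
  have hp := sqrtPow_pos e (n := k + 1) (by omega)
  have := hb (x := k) hp.ne'
  rwa [Real.norm_of_nonneg hp.le, Real.norm_eq_abs] at this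

lemma sum_pruneProb_mul_isBigO {f : ℕ → ℝ} {j : ℕ} (hf : f =O[atTop] sqrtPow (j - 2)) (l : ℕ) :
    (fun n => ∑ m ∈ range (n + 1), pruneProb n m * (((m : ℝ) - n / 4) ^ l * f m))
      =O[atTop] sqrtPow (l + j - 2) := by
  obtain ⟨C, hC, hb⟩ := exists_bound_of_isBigO hf
  have h1 := isBigO_sqrtPow_mul (isBigO_refl (sqrtPow (j - 2)) atTop)
    (pruneAbsMoment_isBigO l) (c := l + j - 2) (by linarith)
  have h2 := isBigO_sqrtPow_mul (isBigO_refl (sqrtPow (j - 4)) atTop)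
    (pruneAbsMoment_isBigO (l + 2)) (c := l + j - 2) (by push_cast; linarith)
  refine IsBigO.trans (IsBigO.of_bound C ?_) ((h1.const_mul_left 8).add (h2.const_mul_left 64))
  filter_upwards [eventually_ge_atTop 1] with n hn
  refine (abs_sum_le_sum_abs _ _).trans (le_trans ?_
    (mul_le_mul_of_nonneg_left (le_abs_self _) hC))
  simp only [pruneAbsMoment, mul_sum, ← sum_add_distrib]
  refine sum_le_sum fun m hm => ?_
  have hp := pruneProb_nonneg n m
  rcases Nat.eq_zero_or_pos m with rfl | hm1
  · simp [pruneProb_zero]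
  have hle := sqrtPow_sub_two_le (j := j) hm1 (Nat.lt_succ_iff.1 (mem_range.1 hm))
  have ha := (hb m hm1).trans (mul_le_mul_of_nonneg_left hle hC)
  rw [abs_mul, abs_mul, abs_of_nonneg hp, abs_pow]
  have e2 : sqrtPow (j - 2) n = sqrtPow j n * sqrtPow (-2) n := by
    rw [sqrtPow_mul _ _ hn, sub_eq_add_neg]
  have e4 : sqrtPow (j - 4) n = sqrtPow j n * sqrtPow (-4) n := by
    rw [sqrtPow_mul _ _ hn, sub_eq_add_neg]
  rw [e2, e4]
  have := mul_le_mul_of_nonneg_left ha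
    (mul_nonneg hp (pow_nonneg (abs_nonneg ((m : ℝ) - n / 4)) l))
  refine (le_of_eq (by ring)).trans (this.trans (le_of_eq ?_))
  rw [pow_add]
  ring

/-- The coefficient of the leading term of the expectation of `(m - n / 4) ^ l * m ^ d`. -/
noncomputable def mixedLead (l d : ℕ) : ℝ :=
  (1 / 4) ^ d * leadCoeff (1 / 32) (1 / 8) 0 l +
    if Even l then 0 else d * (1 / 4) ^ (d - 1) * leadCoeff (1 / 32) (1 / 8) 0 (l + 1)

lemma sum_pruneProb_pow_hasLead (l d : ℕ) :
    HasLead (l + 2 * d)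
      (fun n => ∑ m ∈ range (n + 1), pruneProb n m * (((m : ℝ) - n / 4) ^ l * (m : ℝ) ^ d))
      (mixedLead l d) := by
  set c := leadCoeff (1 / 32) (1 / 8) 0 with hc
  have hterm : ∀ i ∈ range (d + 1), HasLead (l + 2 * d)
      (fun n => (d.choose i * (1 / 4) ^ (d - i)) * ((n : ℝ) ^ (d - i) * pruneMoment (l + i) n))
      ((d.choose i * (1 / 4) ^ (d - i)) *
        (if i = 0 then c l else if i = 1 then if Even l then 0 else c (l + 1) else 0)) := by
    intro i hi
    rw [mem_range] at hi
    refine HasLead.const_mul _ ?_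
    have h := (pruneMoment_hasLead (l + i)).pow_mul (d - i)
    match i with
    | 0 => simpa [hc] using h
    | 1 =>
      have h' := h.succ
      have e : l + 1 + 2 * (d - 1) + 1 = l + 2 * d := by omega
      rw [e] at h'
      refine h'.congr' (Eventually.of_forall fun n => rfl) ?_
      have : Even (l + 1 + 2 * (d - 1)) ↔ ¬ Even l := by simp [Nat.even_add, parity_simps]
      simp only [this]
      split_ifs <;> simp_all
    | i + 2 =>
      simp only [Nat.add_eq_zero_iff, OfNat.ofNat_ne_zero, and_false, if_false]
      rw [if_neg (by omega)]
      refine HasLead.of_isBigO (h.isBigO.trans (sqrtPow_isBigO ?_))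
      push_cast
      omega
  refine (HasLead.sum _ hterm).congr' (Eventually.of_forall fun n => ?_) ?_
  · simp only [pruneMoment, mul_sum]
    rw [sum_comm]
    refine sum_congr rfl fun m _ => ?_
    have hm : (m : ℝ) ^ d = (((m : ℝ) - n / 4) + n / 4) ^ d := by ring
    rw [hm, add_pow, mul_sum, mul_sum]
    refine sum_congr rfl fun i _ => ?_
    rw [pow_add, div_pow, div_pow, one_pow]
    ring
  · rw [mixedLead, sum_range_succ']
    rcases d with _ | d
    · simp [hc]
    · rw [sum_range_succ', sum_eq_zero]
      · simp [hc]
        split_ifs <;> ring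
      · intro i _
        simp

/-- The coefficient of the leading term of the expectation of `(m - n / 4) ^ l * f m`, when
`f` has leading coefficient 1 at level `j`. -/
noncomputable def weightedLead (l j : ℕ) : ℝ :=
  if Even j then mixedLead l (j / 2) else if Even l then mixedLead l (j / 2) else 0

lemma sum_pruneProb_mul_hasLead {f : ℕ → ℝ} {j : ℕ} {c : ℝ} (hf : HasLead j f c) (l : ℕ) :
    HasLead (l + j)
      (fun n => ∑ m ∈ range (n + 1), pruneProb n m * (((m : ℝ) - n / 4) ^ l * f m))
      (c * weightedLead l j) := by
  have hmain : HasLead (l + j) (fun n => ∑ m ∈ range (n + 1),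
      pruneProb n m * (((m : ℝ) - n / 4) ^ l * (m : ℝ) ^ (j / 2))) (weightedLead l j) := by
    have h := sum_pruneProb_pow_hasLead l (j / 2)
    rcases Nat.even_or_odd' j with ⟨i, rfl | rfl⟩
    · rw [Nat.mul_div_cancel_left _ two_pos] at h ⊢
      simpa [weightedLead] using h
    · have e : (2 * i + 1) / 2 = i := by omega
      rw [e] at h ⊢
      have h' := h.succ
      refine h'.congr' (Eventually.of_forall fun n => rfl) ?_
      simp [weightedLead, e, Nat.even_add]
  have herr : HasLead (l + j) (fun n => ∑ m ∈ range (n + 1),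
      pruneProb n m * (((m : ℝ) - n / 4) ^ l * (f m - c * (m : ℝ) ^ (j / 2)))) 0 := by
    refine HasLead.of_isBigO ?_
    have := sum_pruneProb_mul_isBigO hf l
    exact_mod_cast this
  refine ((hmain.const_mul c).add herr).congr' (Eventually.of_forall fun n => ?_) (by ring)
  rw [mul_sum, ← sum_add_distrib]
  exact sum_congr rfl fun m _ => by ring

/-- The `k`-th moment of the number of branches of order `r + 1` about `n / 4 ^ r`. -/
noncomputable def branchMoment (r k n : ℕ) : ℝ :=
  _root_.expect n fun τ => ((τ.branches (r + 1) : ℝ) - (n : ℝ) / 4 ^ r) ^ k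

lemma branchMoment_succ (r k : ℕ) {n : ℕ} (hn : 2 ≤ n) :
    branchMoment (r + 1) k n = ∑ j ∈ range (k + 1), (k.choose j * ((1 / 4) ^ r) ^ (k - j)) *
      ∑ m ∈ range (n + 1), pruneProb n m *
        (((m : ℝ) - n / 4) ^ (k - j) * branchMoment r j m) := by
  rw [branchMoment, expect_branches_succ hn r fun b => ((b : ℝ) - (n : ℝ) / 4 ^ (r + 1)) ^ k]
  simp only [mul_sum]
  rw [sum_comm]
  refine sum_congr rfl fun m _ => ?_
  simp only [branchMoment, _root_.expect]
  have hx : ∀ τ : BinTree, ((τ.branches (r + 1) : ℝ) - (n : ℝ) / 4 ^ (r + 1)) ^ k =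
      ∑ j ∈ range (k + 1), (k.choose j * ((1 / 4) ^ r) ^ (k - j)) *
        (((m : ℝ) - n / 4) ^ (k - j) * ((τ.branches (r + 1) : ℝ) - (m : ℝ) / 4 ^ r) ^ j) := by
    intro τ
    have e : (τ.branches (r + 1) : ℝ) - (n : ℝ) / 4 ^ (r + 1) =
        ((τ.branches (r + 1) : ℝ) - (m : ℝ) / 4 ^ r) + (1 / 4) ^ r * ((m : ℝ) - n / 4) := by
      rw [one_div, inv_pow, pow_succ]
      field_simp
      ring
    rw [e, add_pow]
    refine sum_congr rfl fun j _ => ?_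
    rw [mul_pow]
    ring
  simp only [hx]
  rw [sum_comm, sum_div, mul_sum]
  refine sum_congr rfl fun j _ => ?_
  rw [← mul_sum, ← mul_sum]
  ring

lemma sum_range_two_mul (f : ℕ → ℝ) (t : ℕ) :
    ∑ j ∈ range (2 * t), f j = ∑ i ∈ range t, (f (2 * i) + f (2 * i + 1)) := by
  induction t with
  | zero => simp
  | succ t ih => rw [mul_add_one, sum_range_succ, sum_range_succ, ih, sum_range_succ]; ring

lemma sum_choose_mul_pow (V W : ℝ) (s : ℕ) :
    ∑ i ∈ range (s + 1), (s.choose i : ℝ) * (V ^ i * W ^ (s - i)) = (V + W) ^ s := by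
  rw [add_pow]
  exact sum_congr rfl fun i _ => by ring

lemma sum_choose_mul_id_mul_pow (V W : ℝ) (s : ℕ) :
    ∑ i ∈ range (s + 1), (s.choose i : ℝ) * (i * V ^ (i - 1) * W ^ (s - i)) =
      s * (V + W) ^ (s - 1) := by
  rcases s with _ | s
  · simp
  · rw [sum_range_succ', Nat.add_sub_cancel, ← sum_choose_mul_pow, mul_sum]
    simp only [Nat.cast_zero, zero_mul, mul_zero, add_zero, Nat.add_sub_cancel,
      Nat.add_sub_add_right]
    refine sum_congr rfl fun i _ => ?_
    have h := congrArg (Nat.cast (R := ℝ)) (Nat.add_one_mul_choose_eq s i)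
    push_cast at h ⊢
    linear_combination (-(V ^ i * W ^ (s - i))) * h

lemma leadCoeff_transfer (v p w θ : ℝ) (k : ℕ) :
    ∑ j ∈ range (k + 1), (k.choose j * θ ^ (k - j)) *
        (leadCoeff v p w j * weightedLead (k - j) j) =
      leadCoeff (v / 4 + θ ^ 2 / 32) (p + θ / 8) (θ * v / 16 + w / 4) k := by
  rcases Nat.even_or_odd' k with ⟨s, rfl | rfl⟩
  · have hodd : ∀ i ∈ range s, (((2 * s).choose (2 * i + 1) : ℝ) * θ ^ (2 * s - (2 * i + 1))) *
        (leadCoeff v p w (2 * i + 1) * weightedLead (2 * s - (2 * i + 1)) (2 * i + 1)) = 0 := by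
      intro i hi
      obtain ⟨h, rfl⟩ := Nat.exists_eq_add_of_lt (mem_range.1 hi)
      have e : 2 * (i + h + 1) - (2 * i + 1) = 2 * h + 1 := by omega
      simp [weightedLead, e]
    have heven : ∀ i ∈ range (s + 1), (((2 * s).choose (2 * i) : ℝ) * θ ^ (2 * s - 2 * i)) *
        (leadCoeff v p w (2 * i) * weightedLead (2 * s - 2 * i) (2 * i)) =
        ((2 * s).factorial : ℝ) / s.factorial *
          (s.choose i * ((v / 4) ^ i * (θ ^ 2 / 32) ^ (s - i))) := by
      intro i hi
      obtain ⟨h, rfl⟩ := Nat.exists_eq_add_of_le (Nat.lt_succ_iff.1 (mem_range.1 hi))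
      have e : 2 * (i + h) - 2 * i = 2 * h := by omega
      rw [e, Nat.add_sub_cancel_left, mul_add, Nat.cast_add_choose, Nat.cast_add_choose,
        leadCoeff_even]
      simp only [weightedLead, even_two_mul, if_true, mixedLead, add_zero,
        Nat.mul_div_cancel_left _ two_pos, leadCoeff_even]
      rw [div_pow v, div_pow (θ ^ 2), div_pow, div_pow, pow_mul θ]
      field_simp
      simp
    rw [sum_range_succ, sum_range_two_mul, sum_add_distrib, sum_eq_zero hodd, add_zero,
      ← sum_range_succ (fun i => (((2 * s).choose (2 * i) : ℝ) * θ ^ (2 * s - 2 * i)) *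
        (leadCoeff v p w (2 * i) * weightedLead (2 * s - 2 * i) (2 * i))), sum_congr rfl heven,
      ← mul_sum, sum_choose_mul_pow, leadCoeff_even]
  · have hterm : ∀ i ∈ range (s + 1),
        (((2 * s + 1).choose (2 * i) : ℝ) * θ ^ (2 * s + 1 - 2 * i)) *
          (leadCoeff v p w (2 * i) * weightedLead (2 * s + 1 - 2 * i) (2 * i)) +
        (((2 * s + 1).choose (2 * i + 1) : ℝ) * θ ^ (2 * s + 1 - (2 * i + 1))) *
          (leadCoeff v p w (2 * i + 1) * weightedLead (2 * s + 1 - (2 * i + 1)) (2 * i + 1)) =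
        ((2 * s + 1).factorial : ℝ) / s.factorial *
          ((p + θ / 8) * (s.choose i * ((v / 4) ^ i * (θ ^ 2 / 32) ^ (s - i))) +
          (θ * v / 16 + w / 4) *
            (s.choose i * (i * (v / 4) ^ (i - 1) * (θ ^ 2 / 32) ^ (s - i)))) := by
      intro i hi
      obtain ⟨h, rfl⟩ := Nat.exists_eq_add_of_le (Nat.lt_succ_iff.1 (mem_range.1 hi))
      have e1 : 2 * (i + h) + 1 - 2 * i = 2 * h + 1 := by omega
      have e2 : 2 * (i + h) + 1 - (2 * i + 1) = 2 * h := by omega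
      have e3 : (2 * i + 1) / 2 = i := by omega
      have c1 : ((2 * (i + h) + 1).choose (2 * i) : ℝ) =
          (2 * (i + h) + 1).factorial / ((2 * i).factorial * (2 * h + 1).factorial) := by
        rw [(by ring : 2 * (i + h) + 1 = 2 * i + (2 * h + 1)), Nat.cast_add_choose]
      have c2 : ((2 * (i + h) + 1).choose (2 * i + 1) : ℝ) =
          (2 * (i + h) + 1).factorial / ((2 * i + 1).factorial * (2 * h).factorial) := by
        rw [(by ring : 2 * (i + h) + 1 = (2 * i + 1) + 2 * h), Nat.cast_add_choose]
      rw [e1, e2, c1, c2, Nat.add_sub_cancel_left, Nat.cast_add_choose ℝ (a := i),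
        leadCoeff_even, leadCoeff_odd]
      have l1 : weightedLead (2 * h + 1) (2 * i) = (2 * h + 1).factorial / h.factorial *
          (1 / 32) ^ h * ((1 / 4) ^ i / 8 + i * (1 / 4) ^ (i - 1) / 16) := by
        simp only [weightedLead, even_two_mul, if_true, mixedLead,
          Nat.mul_div_cancel_left _ two_pos, leadCoeff_odd]
        rw [if_neg (by simp), (by ring : 2 * h + 1 + 1 = 2 * (h + 1)), leadCoeff_even,
          (by ring : 2 * (h + 1) = 2 * h + 1 + 1)]
        simp only [Nat.factorial_succ]
        push_cast
        field_simp
        ring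
      have l2 : weightedLead (2 * h) (2 * i + 1) = (2 * h).factorial / h.factorial *
          (1 / 32) ^ h * (1 / 4) ^ i := by
        rw [weightedLead, if_neg (by simp), if_pos (even_two_mul h), mixedLead, e3,
          leadCoeff_even, if_pos (even_two_mul h)]
        ring
      rw [l1, l2]
      have hW : (θ ^ 2 / 32) ^ h = θ ^ (2 * h) * (1 / 32) ^ h := by
        rw [div_eq_mul_one_div, mul_pow, pow_mul]
      have hV : (v / 4) ^ i = v ^ i * (1 / 4) ^ i := by rw [div_eq_mul_one_div, mul_pow]
      rw [hW]
      rcases i with _ | i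
      · field_simp
        simp
        ring
      · rw [Nat.add_sub_cancel, hV, (by ring : v / 4 = v * (1 / 4)), mul_pow v (1 / 4) i,
          pow_succ v i, pow_succ (1 / 4 : ℝ) i, pow_succ θ]
        generalize (1 / 4 : ℝ) ^ i = Q
        generalize (1 / 32 : ℝ) ^ h = U
        field_simp
        ring
    rw [(by ring : 2 * s + 1 + 1 = 2 * (s + 1)), sum_range_two_mul, sum_congr rfl hterm,
      ← mul_sum, sum_add_distrib, ← mul_sum, ← mul_sum, sum_choose_mul_pow,
      sum_choose_mul_id_mul_pow, leadCoeff_odd]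

lemma branchMoment_zero_left {k n : ℕ} (hn : 1 ≤ n) : branchMoment 0 k n = 0 ^ k := by
  have h : ∀ τ ∈ treesOf n, ((τ.branches (0 + 1) : ℝ) - (n : ℝ) / 4 ^ 0) ^ k = 0 ^ k := by
    intro τ hτ
    rw [mem_treesOf] at hτ
    rw [zero_add, branches_one, hτ]
    simp
  have := card_treesOf_pos hn
  rw [branchMoment, _root_.expect, sum_congr rfl h, sum_const, nsmul_eq_mul]
  field_simp

lemma branchMoment_hasLead (r k : ℕ) {θ : ℝ} (hθ : θ = (1 / 4) ^ r) :
    HasLead k (branchMoment r k)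
      (leadCoeff ((θ - θ ^ 2) / 6) ((1 - θ) / 6) ((1 - 4 * θ) * (θ - θ ^ 2) / 90) k) := by
  induction r generalizing k θ with
  | zero =>
    subst hθ
    refine HasLead.congr' (u := fun _ => 0 ^ k) (c := 0 ^ k) ?_ ?_ ?_
    · rcases k with _ | k
      · simpa [HasLead] using isBigO_zero _ _
      · simpa using HasLead.zero
    · filter_upwards [eventually_ge_atTop 1] with n hn
      exact (branchMoment_zero_left hn).symm
    · rcases Nat.even_or_odd' k with ⟨s, rfl | rfl⟩
      · rw [leadCoeff_even]
        rcases s with _ | s <;> simp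
      · rw [leadCoeff_odd]
        simp
  | succ r ih =>
    have hterm : ∀ j ∈ range (k + 1), HasLead k
        (fun n => (k.choose j * ((1 / 4) ^ r) ^ (k - j)) *
          ∑ m ∈ range (n + 1), pruneProb n m *
            (((m : ℝ) - n / 4) ^ (k - j) * branchMoment r j m))
        ((k.choose j * ((1 / 4) ^ r) ^ (k - j)) *
          (leadCoeff (((1 / 4) ^ r - ((1 / 4) ^ r) ^ 2) / 6) ((1 - (1 / 4) ^ r) / 6)
            ((1 - 4 * (1 / 4) ^ r) * ((1 / 4) ^ r - ((1 / 4) ^ r) ^ 2) / 90) j *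
              weightedLead (k - j) j)) := by
      intro j hj
      have h := sum_pruneProb_mul_hasLead (ih j rfl) (k - j)
      rw [Nat.sub_add_cancel (Nat.lt_succ_iff.1 (mem_range.1 hj))] at h
      exact h.const_mul _
    refine (HasLead.sum _ hterm).congr' ?_ ?_
    · filter_upwards [eventually_ge_atTop 2] with n hn
      exact (branchMoment_succ r k hn).symm
    · rw [leadCoeff_transfer, hθ, pow_succ]
      congr 1 <;> ring

lemma HasLead.tendsto_div {s : ℕ} {u : ℕ → ℝ} {c : ℝ} (hu : HasLead (2 * s + 1) u c)
    (hc : c ≠ 0) : Tendsto (fun n : ℕ => u n / (c * (n : ℝ) ^ s)) atTop (𝓝 1) := by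
  have e : (2 * s + 1) / 2 = s := by omega
  rw [HasLead, e] at hu
  have hinv : (fun n : ℕ => ((n : ℝ) ^ s)⁻¹) =O[atTop] sqrtPow (-(2 * s)) := by
    refine EventuallyEq.isBigO (Eventually.of_forall fun n => ?_)
    rw [sqrtPow, zpow_neg, ← sqrtPow, sqrtPow_two_mul]
  have h1 := isBigO_sqrtPow_mul hu hinv (c := -1) (by push_cast; linarith)
  have h2 : Tendsto (sqrtPow (-1)) atTop (𝓝 0) := by
    have : sqrtPow (-1) = fun n : ℕ => (√(n : ℝ))⁻¹ := by
      funext n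
      rw [sqrtPow, zpow_neg_one]
    rw [this]
    exact (Real.tendsto_sqrt_atTop.comp tendsto_natCast_atTop_atTop).inv_tendsto_atTop
  have h3 := ((h1.trans_tendsto h2).div_const c).const_add 1
  rw [zero_div, add_zero] at h3
  refine h3.congr' ?_
  filter_upwards [eventually_ge_atTop 1] with n hn
  have : (n : ℝ) ≠ 0 := by positivity
  field_simp
  ring

lemma leadCoeff_branches {r s : ℕ} (hr : 1 ≤ r) {θ : ℝ} (hθ : θ = (1 / 4) ^ r) :
    leadCoeff ((θ - θ ^ 2) / 6) ((1 - θ) / 6) ((1 - 4 * θ) * (θ - θ ^ 2) / 90) (2 * s + 1) =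
      (Nat.doubleFactorial (2 * s + 1) : ℝ) / (2 * 4 ^ ((2 * s + 1) * r))
        * (((4 : ℝ) ^ r - 1) / 3) ^ s
        * (1 / 5) * (((4 : ℝ) ^ (r + 1) - 1) / 3
            + 4 * (2 * s + 1) * (((4 : ℝ) ^ (r - 1) - 1) / 3)) := by
  obtain ⟨R, rfl⟩ := Nat.exists_eq_add_of_le' hr
  have hf : ((2 * s + 1).factorial : ℝ) =
      Nat.doubleFactorial (2 * s + 1) * (2 ^ s * s.factorial) := by
    rw [Nat.factorial_eq_mul_doubleFactorial, Nat.doubleFactorial_two_mul]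
    push_cast
    ring
  set y : ℝ := 4 ^ (R + 1) with hy
  have hy4 : (4 : ℝ) ≤ y := by
    rw [hy, pow_succ]
    have := one_le_pow₀ (n := R) (by norm_num : (1 : ℝ) ≤ 4)
    linarith
  have hθy : θ = 1 / y := by rw [hθ, hy, div_pow, one_pow]
  have e1 : (4 : ℝ) ^ (R + 1 + 1) = 4 * y := by rw [hy]; ring
  have e2 : (4 : ℝ) ^ (R + 1 - 1) = y / 4 := by rw [hy, Nat.add_sub_cancel]; ring
  have e3 : (4 : ℝ) ^ ((2 * s + 1) * (R + 1)) = (y ^ 2) ^ s * y := by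
    rw [hy, ← pow_mul, ← pow_mul, ← pow_add]
    congr 1
    ring
  have hv : (θ - θ ^ 2) / 6 = (1 / 2) * ((y - 1) / 3) / y ^ 2 := by
    rw [hθy]; field_simp; ring
  rw [leadCoeff_odd, e1, e2, e3, hf]
  have hv0 : (θ - θ ^ 2) / 6 ≠ 0 := by
    rw [hv]
    have : 0 < y - 1 := by linarith
    positivity
  have hpow : ((1 - 4 * θ) * (θ - θ ^ 2) / 90) * (s * ((θ - θ ^ 2) / 6) ^ (s - 1)) =
      (1 - 4 * θ) / 15 * s * ((θ - θ ^ 2) / 6) ^ s := by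
    rcases s with _ | s
    · simp
    · rw [Nat.add_sub_cancel, pow_succ]
      ring
  rw [hpow, hv, hθy, div_pow, mul_pow, div_pow, one_pow]
  have hy0 : y ≠ 0 := by positivity
  field_simp
  ring

lemma leadCoeff_branches_pos {r s : ℕ} (hr : 1 ≤ r) :
    0 < (Nat.doubleFactorial (2 * s + 1) : ℝ) / (2 * 4 ^ ((2 * s + 1) * r))
        * (((4 : ℝ) ^ r - 1) / 3) ^ s
        * (1 / 5) * (((4 : ℝ) ^ (r + 1) - 1) / 3
            + 4 * (2 * s + 1) * (((4 : ℝ) ^ (r - 1) - 1) / 3)) := by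
  have h1 : (1 : ℝ) < 4 ^ r := one_lt_pow₀ (by norm_num) (by omega)
  have h2 : (1 : ℝ) < 4 ^ (r + 1) := one_lt_pow₀ (by norm_num) (by omega)
  have h3 : (1 : ℝ) ≤ 4 ^ (r - 1) := one_le_pow₀ (by norm_num)
  have h4 : 0 < (4 : ℝ) ^ r - 1 := by linarith
  have h5 : 0 < (4 : ℝ) ^ (r + 1) - 1 := by linarith
  have h6 : 0 ≤ (4 : ℝ) ^ (r - 1) - 1 := by linarith
  have h7 := Nat.doubleFactorial_pos (2 * s + 1)
  positivity

end

/-- Odd central moments of branch numbers (Lemma 2, odd case): for `r ≥ 1`, `s ≥ 0`,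
`⟨(S_{r+1,n} − n/4^r)^{2s+1}⟩ ∼ ((2s+1)!!/(2·4^{(2s+1)r})) ((4^r−1)/3)^s
  · (1/5)((4^{r+1}−1)/3 + 4(2s+1)(4^{r−1}−1)/3) · n^s`. -/
theorem odd_central_moments_branches (r s : ℕ) (hr : 1 ≤ r) :
    Tendsto (fun n : ℕ =>
        expect n (fun τ =>
            ((BinTree.branches (r+1) τ : ℝ) - (n : ℝ) / 4 ^ r) ^ (2*s+1))
          / ((Nat.doubleFactorial (2*s + 1) : ℝ) / (2 * 4 ^ ((2*s+1)*r))
              * (((4 : ℝ) ^ r - 1) / 3) ^ s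
              * (1/5) * (((4 : ℝ) ^ (r+1) - 1) / 3
                  + 4 * (2*s+1) * (((4 : ℝ) ^ (r-1) - 1) / 3))
              * (n : ℝ) ^ s))
      atTop (𝓝 1) := by
  have h := (branchMoment_hasLead r (2 * s + 1) rfl).tendsto_div
    (by rw [leadCoeff_branches hr rfl]; exact (leadCoeff_branches_pos hr).ne')
  rw [leadCoeff_branches hr rfl] at h
  exact h
end

section
/- Recursion for averages against polynomials (Proposition 1): for every two-variable real polynomial p and every integer n ≥ 3, ⟨S_{2,n}·p(S_{2,n}, n)⟩ = (n/2)·⟨p(S_{2,n}, n)⟩ − (n(n−2)/(2(2n−3)))·⟨p(S_{2,n−1}, n)⟩, where the first two expectations are over Ω_n with measure P_n and the third is over Ω_{n−1} with measure P_{n−1} (with n kept fixed in the second argument of p). -/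
open MeasureTheory ProbabilityTheory Filter
open scoped NNReal Topology

namespace BinTree

lemma one_le_ord (τ : BinTree) : 1 ≤ ord τ := by
  induction τ with
  | leaf => simp [ord]
  | node l r hl hr =>
    rw [ord]
    split_ifs
    · omega
    · exact hl.trans (le_max_left _ _)

lemma two_le_ord_node (l r : BinTree) : 2 ≤ ord (node l r) := by
  have hl := one_le_ord l
  have hr := one_le_ord r
  rw [ord]
  split_ifs with h
  · omega
  · rcases lt_or_gt_of_ne h with h | h
    · exact le_max_of_le_right (by omega)
    · exact le_max_of_le_left (by omega)

lemma eq_leaf_of_ord_eq_one {τ : BinTree} (h : ord τ = 1) : τ = leaf := by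
  cases τ with
  | leaf => rfl
  | node l r => have := two_le_ord_node l r; omega

/-- A node with at least three leaves below it does not head a branch of order two. -/
lemma branches_two_node {l r : BinTree} (h : 3 ≤ magnitude l + magnitude r) :
    branches 2 (node l r) = branches 2 l + branches 2 r := by
  rw [branches, if_neg, add_zero]
  rintro ⟨h₁, h₂⟩
  have hl := eq_leaf_of_ord_eq_one (τ := l) (by omega)
  have hr := eq_leaf_of_ord_eq_one (τ := r) (by omega)
  subst hl hr
  simp [magnitude] at h

end BinTree

open BinTree

lemma mem_treesOf_add_two {n : ℕ} {τ : BinTree} :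
    τ ∈ treesOf (n + 2) ↔ ∃ k < n + 1, ∃ l ∈ treesOf (k + 1), ∃ r ∈ treesOf (n + 1 - k),
      node l r = τ := by
  rw [treesOf]
  simp only [Finset.mem_biUnion, Finset.mem_attach, true_and, Subtype.exists, Finset.mem_image,
    Finset.mem_product, Prod.exists, Finset.mem_range]
  constructor
  · rintro ⟨k, hk, l, r, ⟨hl, hr⟩, h⟩
    exact ⟨k, hk, l, hl, r, hr, h⟩
  · rintro ⟨k, hk, l, hl, r, hr, h⟩
    exact ⟨k, hk, l, r, ⟨hl, hr⟩, h⟩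

lemma magnitude_of_mem_treesOf {n : ℕ} {τ : BinTree} (h : τ ∈ treesOf n) : magnitude τ = n := by
  induction τ generalizing n with
  | leaf =>
    match n with
    | 0 => simp [treesOf] at h
    | 1 => rfl
    | n + 2 =>
      obtain ⟨k, -, l, -, r, -, h⟩ := mem_treesOf_add_two.1 h
      cases h
  | node l r hl hr =>
    match n with
    | 0 => simp [treesOf] at h
    | 1 => simp [treesOf] at h
    | n + 2 =>
      obtain ⟨k, hk, l', hl', r', hr', h⟩ := mem_treesOf_add_two.1 h
      cases h
      rw [magnitude, hl hl', hr hr']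
      omega

/-- Summing over binary trees by splitting at the root. -/
lemma sum_treesOf_add_two {M : Type*} [AddCommMonoid M] (n : ℕ) (g : BinTree → M) :
    ∑ τ ∈ treesOf (n + 2), g τ = ∑ ij ∈ Finset.HasAntidiagonal.antidiagonal n,
      ∑ l ∈ treesOf (ij.1 + 1), ∑ r ∈ treesOf (ij.2 + 1), g (node l r) := by
  rw [treesOf, Finset.sum_biUnion]
  · rw [Finset.Nat.sum_antidiagonal_eq_sum_range_succ
      (fun i j => ∑ l ∈ treesOf (i + 1), ∑ r ∈ treesOf (j + 1), g (node l r)),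
      ← Finset.sum_attach (Finset.range n.succ)]
    refine Finset.sum_congr rfl fun k _ => ?_
    have hk := Finset.mem_range.1 k.2
    rw [Finset.sum_image, Finset.sum_product, show n + 1 - k.1 = n - k.1 + 1 by omega]
    rintro ⟨a, b⟩ - ⟨c, d⟩ - h
    simpa using h
  · intro i _ j _ hij
    refine Finset.disjoint_left.2 fun τ hi hj => hij (Subtype.ext ?_)
    simp only [Finset.mem_image, Finset.mem_product, Prod.exists] at hi hj
    obtain ⟨a, b, ⟨ha, -⟩, rfl⟩ := hi
    obtain ⟨c, d, ⟨hc, -⟩, h⟩ := hj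
    cases h
    have := (magnitude_of_mem_treesOf ha).symm.trans (magnitude_of_mem_treesOf hc)
    omega

lemma card_treesOf_succ (n : ℕ) : (treesOf (n + 1)).card = catalan n := by
  induction n using Nat.strong_induction_on with
  | _ n ih =>
    match n with
    | 0 => simp [treesOf]
    | n + 1 =>
      rw [Finset.card_eq_sum_ones, sum_treesOf_add_two, catalan_succ']
      refine Finset.sum_congr rfl fun ij hij => ?_
      have := Finset.HasAntidiagonal.mem_antidiagonal.1 hij
      rw [← ih ij.1 (by omega), ← ih ij.2 (by omega)]
      simp

lemma add_two_mul_catalan_succ (n : ℕ) :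
    (n + 2) * catalan (n + 1) = 2 * (2 * n + 1) * catalan n := by
  have h₁ := succ_mul_catalan_eq_centralBinom (n + 1)
  have h₂ := succ_mul_catalan_eq_centralBinom n
  have h₃ := Nat.succ_mul_centralBinom_succ n
  rw [← h₁, ← h₂] at h₃
  refine Nat.eq_of_mul_eq_mul_left (Nat.succ_pos n) ?_
  simp only [Nat.succ_eq_add_one]
  linarith

/-- Splitting at the root for statistics that only depend on the number of branches of order
two. -/
lemma sum_treesOf_branches_two {n : ℕ} (hn : 1 ≤ n) (g : ℕ → ℝ) :
    ∑ τ ∈ treesOf (n + 2), g (branches 2 τ) = ∑ ij ∈ Finset.HasAntidiagonal.antidiagonal n,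
      ∑ l ∈ treesOf (ij.1 + 1), ∑ r ∈ treesOf (ij.2 + 1), g (branches 2 l + branches 2 r) := by
  rw [sum_treesOf_add_two]
  refine Finset.sum_congr rfl fun ij hij => Finset.sum_congr rfl fun l hl =>
    Finset.sum_congr rfl fun r hr => ?_
  have := Finset.HasAntidiagonal.mem_antidiagonal.1 hij
  rw [branches_two_node]
  rw [magnitude_of_mem_treesOf hl, magnitude_of_mem_treesOf hr]
  omega

/-- Counting pairs of a tree with `n + 2` leaves and a leaf outside all cherries: deleting the leaf
gives a tree with `n + 1` leaves together with an internal node and a side. -/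
lemma sum_treesOf_sub_two_mul_branches (n : ℕ) (f : ℕ → ℝ) :
    ∑ τ ∈ treesOf (n + 2), ((n : ℝ) + 2 - 2 * (branches 2 τ : ℝ)) * f (branches 2 τ)
      = 2 * n * ∑ τ ∈ treesOf (n + 1), f (branches 2 τ) := by
  induction n using Nat.strong_induction_on generalizing f with
  | _ n ih =>
    match n with
    | 0 => rw [sum_treesOf_add_two]; simp [treesOf, branches, ord]
    | m + 1 =>
      have hleaf (g : BinTree → ℝ) : ∑ τ ∈ treesOf (0 + 1), g τ = g leaf := by simp [treesOf]
      have hb : branches 2 leaf = 0 := by simp [branches]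
      rw [sum_treesOf_branches_two (by omega)
        (fun s => (((m + 1 : ℕ) : ℝ) + 2 - 2 * (s : ℝ)) * f s)]
      have hsplit : ∀ ij ∈ Finset.HasAntidiagonal.antidiagonal (m + 1),
          ∑ l ∈ treesOf (ij.1 + 1), ∑ r ∈ treesOf (ij.2 + 1),
            (((m + 1 : ℕ) : ℝ) + 2 - 2 * ((branches 2 l + branches 2 r : ℕ) : ℝ)) *
              f (branches 2 l + branches 2 r)
          = (∑ r ∈ treesOf (ij.2 + 1), ∑ l ∈ treesOf (ij.1 + 1),
              ((ij.1 : ℝ) + 1 - 2 * branches 2 l) * f (branches 2 l + branches 2 r))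
            + ∑ l ∈ treesOf (ij.1 + 1), ∑ r ∈ treesOf (ij.2 + 1),
              ((ij.2 : ℝ) + 1 - 2 * branches 2 r) * f (branches 2 l + branches 2 r) := by
        intro ij hij
        have h : (ij.1 : ℝ) + ij.2 = ((m + 1 : ℕ) : ℝ) := by
          exact_mod_cast Finset.HasAntidiagonal.mem_antidiagonal.1 hij
        rw [Finset.sum_comm (s := treesOf (ij.2 + 1)), ← Finset.sum_add_distrib]
        refine Finset.sum_congr rfl fun l _ => ?_
        rw [← Finset.sum_add_distrib]
        refine Finset.sum_congr rfl fun r _ => ?_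
        rw [← h]
        push_cast
        ring
      rw [Finset.sum_congr rfl hsplit, Finset.sum_add_distrib, Finset.Nat.sum_antidiagonal_succ,
        Finset.Nat.sum_antidiagonal_succ' (n := m)]
      simp only [hleaf, hb]
      have hl : ∀ ij ∈ Finset.HasAntidiagonal.antidiagonal m,
          ∑ r ∈ treesOf (ij.2 + 1), ∑ l ∈ treesOf (ij.1 + 1 + 1),
            (((ij.1 + 1 : ℕ) : ℝ) + 1 - 2 * branches 2 l) * f (branches 2 l + branches 2 r)
          = 2 * ij.1 * ∑ l ∈ treesOf (ij.1 + 1), ∑ r ∈ treesOf (ij.2 + 1),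
              f (branches 2 l + branches 2 r) := by
        intro ij hij
        have := Finset.HasAntidiagonal.mem_antidiagonal.1 hij
        rw [Finset.sum_comm (s := treesOf (ij.1 + 1)), Finset.mul_sum]
        refine Finset.sum_congr rfl fun r _ => ?_
        rw [← ih ij.1 (by omega) fun s => f (s + branches 2 r)]
        refine Finset.sum_congr rfl fun l _ => ?_
        push_cast
        ring
      have hr : ∀ ij ∈ Finset.HasAntidiagonal.antidiagonal m,
          ∑ l ∈ treesOf (ij.1 + 1), ∑ r ∈ treesOf (ij.2 + 1 + 1),
            (((ij.2 + 1 : ℕ) : ℝ) + 1 - 2 * branches 2 r) * f (branches 2 l + branches 2 r)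
          = 2 * ij.2 * ∑ l ∈ treesOf (ij.1 + 1), ∑ r ∈ treesOf (ij.2 + 1),
              f (branches 2 l + branches 2 r) := by
        intro ij hij
        have := Finset.HasAntidiagonal.mem_antidiagonal.1 hij
        rw [Finset.mul_sum]
        refine Finset.sum_congr rfl fun l _ => ?_
        rw [← ih ij.2 (by omega) fun s => f (branches 2 l + s)]
        refine Finset.sum_congr rfl fun r _ => ?_
        push_cast
        ring
      have key : ∑ ij ∈ Finset.HasAntidiagonal.antidiagonal m,
            2 * (ij.1 : ℝ) * ∑ l ∈ treesOf (ij.1 + 1), ∑ r ∈ treesOf (ij.2 + 1),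
              f (branches 2 l + branches 2 r)
          + ∑ ij ∈ Finset.HasAntidiagonal.antidiagonal m,
            2 * (ij.2 : ℝ) * ∑ l ∈ treesOf (ij.1 + 1), ∑ r ∈ treesOf (ij.2 + 1),
              f (branches 2 l + branches 2 r)
          = 2 * m * ∑ τ ∈ treesOf (m + 2), f (branches 2 τ) := by
        rcases Nat.eq_zero_or_pos m with rfl | hm
        · simp
        rw [sum_treesOf_branches_two hm, ← Finset.sum_add_distrib, Finset.mul_sum]
        refine Finset.sum_congr rfl fun ij hij => ?_
        have h : (ij.1 : ℝ) + ij.2 = (m : ℝ) := by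
          exact_mod_cast Finset.HasAntidiagonal.mem_antidiagonal.1 hij
        rw [← h]
        ring
      rw [Finset.sum_congr rfl hl, Finset.sum_congr rfl hr]
      simp only [Nat.cast_zero, mul_zero, sub_zero, zero_add, one_mul, add_zero]
      push_cast
      linear_combination key

/-- Recursion for averages against polynomials (Proposition 1): for every two-variable real
polynomial `p` and every `n ≥ 3`,
`⟨S_{2,n} p(S_{2,n}, n)⟩ = (n/2)⟨p(S_{2,n}, n)⟩ − (n(n−2)/(2(2n−3)))⟨p(S_{2,n−1}, n)⟩`,
the third expectation being over `Ω_{n−1}` with `n` kept fixed in the second argument. -/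
theorem recursion_polynomial_averages (p : MvPolynomial (Fin 2) ℝ) (n : ℕ) (hn : 3 ≤ n) :
    expect n (fun τ => (BinTree.branches 2 τ : ℝ) *
        MvPolynomial.eval ![(BinTree.branches 2 τ : ℝ), (n : ℝ)] p)
      = ((n : ℝ) / 2) *
          expect n (fun τ => MvPolynomial.eval ![(BinTree.branches 2 τ : ℝ), (n : ℝ)] p)
        - ((n : ℝ) * ((n : ℝ) - 2) / (2 * (2 * (n : ℝ) - 3))) *
            expect (n-1) (fun τ => MvPolynomial.eval ![(BinTree.branches 2 τ : ℝ), (n : ℝ)] p) := by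
  obtain ⟨m, rfl⟩ : ∃ m, n = m + 2 := ⟨n - 2, by omega⟩
  have hsum := sum_treesOf_sub_two_mul_branches m
    fun s => MvPolynomial.eval ![(s : ℝ), ((m + 2 : ℕ) : ℝ)] p
  have hcat : ((m : ℝ) + 2) * (treesOf (m + 2)).card
      = 2 * (2 * m + 1) * (treesOf (m + 1)).card := by
    rw [card_treesOf_succ, card_treesOf_succ]
    exact_mod_cast add_two_mul_catalan_succ m
  have hpos (k : ℕ) : ((treesOf (k + 1)).card : ℝ) ≠ 0 := by
    rw [card_treesOf_succ]
    intro h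
    have := succ_mul_catalan_eq_centralBinom k
    rw [Nat.cast_eq_zero.1 h] at this
    exact (Nat.centralBinom_pos k).ne (by simpa using this)
  have h₁ := hpos m
  have h₂ : ((treesOf (m + 2)).card : ℝ) ≠ 0 := hpos (m + 1)
  simp only [sub_mul, Finset.sum_sub_distrib, mul_assoc, ← Finset.mul_sum] at hsum
  simp only [expect, show m + 2 - 1 = m + 1 by omega]
  set A := ∑ τ ∈ treesOf (m + 2), (branches 2 τ : ℝ) *
    MvPolynomial.eval ![(branches 2 τ : ℝ), ((m + 2 : ℕ) : ℝ)] p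
  set B := ∑ τ ∈ treesOf (m + 2), MvPolynomial.eval ![(branches 2 τ : ℝ), ((m + 2 : ℕ) : ℝ)] p
  set C := ∑ τ ∈ treesOf (m + 1), MvPolynomial.eval ![(branches 2 τ : ℝ), ((m + 2 : ℕ) : ℝ)] p
  have hA : A = ((m : ℝ) + 2) / 2 * B - m * C := by linear_combination -hsum / 2
  have h₃ : (2 * (m : ℝ) + 1) ≠ 0 := by positivity
  have hC : C / (treesOf (m + 1)).card
      = 2 * (2 * m + 1) / (m + 2) * (C / (treesOf (m + 2)).card) := by
    have h₄ : (m : ℝ) + 2 ≠ 0 := by positivity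
    field_simp
    linear_combination C * hcat
  rw [hA, hC]
  push_cast
  rw [show 2 * ((m : ℝ) + 2) - 3 = 2 * m + 1 by ring]
  field_simp
  ring
end
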